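/- arXiv:2503.22073 — 2 statements merged into one kernel-verified Lean document; each statement's English description precedes it below -/
import Mathlib

section
/- (Harmonic relation on side BC) Suppose y ≠ z (so D ≠ D₃), suppose D₂ lies on line BC and on line AQ, and suppose H_a lies on line BC and on line AH with H ≠ A. Write D₂ = lineMap D D₃ t and H_a = lineMap D D₃ s for real parameters t, s (possible since D₂ and H_a lie on line DD₃ = BC). Then t + s = 2·t·s; that is, H_a is the harmonic conjugate of D₂ with respect to D and D₃. -/
theorem AffineMap.map_smul_add_smul_add_smul {k V W : Type*} [Ring k] [AddCommGroup V] [Module k V]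
    [AddCommGroup W] [Module k W] (f : V →ᵃ[k] W) {u v w : k} (h : u + v + w = 1) (a b c : V) :
    f (u • a + v • b + w • c) = u • f a + v • f b + w • f c := by
  have hf (p : V) : f p = f.linear p + f 0 := congrFun f.decomp p
  rw [hf, hf a, hf b, hf c]
  conv_lhs => rw [← one_smul k (f 0), ← h]
  simp only [map_add, map_smul, smul_add, add_smul]
  abel

/-- Barycentric coordinates with respect to a triangle are unique. -/
theorem AffineIndependent.coord_eq_of_smul_add_eq {k V : Type*} [Field k] [AddCommGroup V]
    [Module k V] {A B C : V} (h : AffineIndependent k ![A, B, C]) {a b c a' b' c' : k}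
    (hs : a + b + c = a' + b' + c')
    (he : a • A + b • B + c • C = a' • A + b' • B + c' • C) :
    a = a' ∧ b = b' ∧ c = c' := by
  rw [affineIndependent_iff] at h
  have key := h Finset.univ ![a - a', b - b', c - c']
    (by simp [Fin.sum_univ_three]; linear_combination hs)
    (by
      simp only [Fin.sum_univ_three, Matrix.cons_val]
      rw [← sub_eq_zero] at he
      rw [← he]
      module)
  refine ⟨sub_eq_zero.1 ?_, sub_eq_zero.1 ?_, sub_eq_zero.1 ?_⟩
  · simpa using key 0
  · simpa using key 1
  · simpa using key 2

/-- The barycentric coordinates of the preimage of `K Q` under the affine map sending the triangle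
`ABC` to the triangle with vertices `(0, z, y) / (y + z)`, `(z, 0, x) / (z + x)`,
`(y, x, 0) / (x + y)`. -/
theorem cevian_preimage_combination {V : Type*} [AddCommGroup V] [Module ℝ V] (A B C : V)
    {x y z σ : ℝ} (hx : x ≠ 0) (hy : y ≠ 0) (hz : z ≠ 0)
    (hσdef : σ = x * y + y * z + z * x) (hσ : σ ≠ 0) :
    ((y + z) ^ 2 * (σ - x ^ 2) / (8 * σ * (y * z))) • ((y + z)⁻¹ • (z • B + y • C)) +
      ((z + x) ^ 2 * (σ - y ^ 2) / (8 * σ * (z * x))) • ((z + x)⁻¹ • (x • C + z • A)) +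
      ((x + y) ^ 2 * (σ - z ^ 2) / (8 * σ * (x * y))) • ((x + y)⁻¹ • (y • A + x • B)) =
    (4 * σ)⁻¹ • ((x * y + z * x + 2 * (y * z)) • A + (x * y + y * z + 2 * (z * x)) • B +
      (y * z + z * x + 2 * (x * y)) • C) := by
  match_scalars <;> field_simp <;> rw [hσdef] <;> ring

theorem cevian_preimage_weights_sum {x y z σ : ℝ} (hx : x ≠ 0) (hy : y ≠ 0) (hz : z ≠ 0)
    (hσdef : σ = x * y + y * z + z * x) (hσ : σ ≠ 0) :
    (y + z) ^ 2 * (σ - x ^ 2) / (8 * σ * (y * z)) +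
      (z + x) ^ 2 * (σ - y ^ 2) / (8 * σ * (z * x)) +
      (x + y) ^ 2 * (σ - z ^ 2) / (8 * σ * (x * y)) = 1 := by
  field_simp
  rw [hσdef]
  ring

theorem pointReflection_midpoint_smul {V : Type*} [AddCommGroup V] [Module ℝ V] (B C : V)
    {y z : ℝ} (h : y + z ≠ 0) :
    Equiv.pointReflection (midpoint ℝ B C) ((y + z)⁻¹ • (y • B + z • C)) =
      (y + z)⁻¹ • (z • B + y • C) := by
  rw [Equiv.pointReflection_apply, midpoint_eq_smul_add, vsub_eq_sub, vadd_eq_add, invOf_eq_inv]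
  match_scalars <;> field_simp <;> ring

/-- **Theorem 3.4 (side `BC`).** The trace `H_a` of the generalized orthocenter `H` on
`BC` is the harmonic conjugate of the trace `D₂` of `Q` with respect to `D` and `D₃`:
writing `D₂ = lineMap D D₃ t` and `H_a = lineMap D D₃ s`, we have `t + s = 2·t·s`. -/
theorem harmonic_relation_on_BC
    (A B C G P P' Q D E F D₀ E₀ F₀ D₃ E₃ F₃ : EuclideanSpace ℝ (Fin 2))
    (x y z σ : ℝ)
    (hABC : AffineIndependent ℝ ![A, B, C])
    (hG : G = (3 : ℝ)⁻¹ • (A + B + C))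
    (hsum : x + y + z = 1)
    (hx : x ≠ 0) (hy : y ≠ 0) (hz : z ≠ 0)
    (hyz : y + z ≠ 0) (hzx : z + x ≠ 0) (hxy : x + y ≠ 0)
    (hP : P = x • A + y • B + z • C)
    (hD : D = (y + z)⁻¹ • (y • B + z • C))
    (hE : E = (z + x)⁻¹ • (z • C + x • A))
    (hF : F = (x + y)⁻¹ • (x • A + y • B))
    (hD₀ : D₀ = midpoint ℝ B C) (hE₀ : E₀ = midpoint ℝ C A) (hF₀ : F₀ = midpoint ℝ A B)
    (hσdef : σ = x * y + y * z + z * x) (hσ : σ ≠ 0)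
    (hP' : P' = σ⁻¹ • ((y * z) • A + (z * x) • B + (x * y) • C))
    (hD₃ : D₃ = Equiv.pointReflection D₀ D)
    (hE₃ : E₃ = Equiv.pointReflection E₀ E)
    (hF₃ : F₃ = Equiv.pointReflection F₀ F)
    (hD₃E₃F₃ : AffineIndependent ℝ ![D₃, E₃, F₃])
    (hQ : Q = AffineMap.homothety G (-(1 / 2) : ℝ) P')
    (T : EuclideanSpace ℝ (Fin 2) ≃ᵃ[ℝ] EuclideanSpace ℝ (Fin 2))
    (hTA : T A = D₃) (hTB : T B = E₃) (hTC : T C = F₃)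
    (H : EuclideanSpace ℝ (Fin 2))
    (hH : H = AffineMap.homothety G (-2 : ℝ)
      (T.symm (AffineMap.homothety G (-(1 / 2) : ℝ) Q)))
    (hyzne : y ≠ z)
    (D₂ Ha : EuclideanSpace ℝ (Fin 2))
    (hD₂BC : D₂ ∈ line[ℝ, B, C]) (hD₂AQ : D₂ ∈ line[ℝ, A, Q])
    (hHaBC : Ha ∈ line[ℝ, B, C]) (hHaAH : Ha ∈ line[ℝ, A, H]) (hHA : H ≠ A)
    (t s : ℝ)
    (ht : D₂ = AffineMap.lineMap D D₃ t) (hs : Ha = AffineMap.lineMap D D₃ s) :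
    t + s = 2 * t * s := by
  rw [hD, hD₀, pointReflection_midpoint_smul B C hyz] at hD₃
  rw [hE, hE₀, pointReflection_midpoint_smul C A hzx] at hE₃
  rw [hF, hF₀, pointReflection_midpoint_smul A B hxy] at hF₃
  have hQ' : Q = (2 * σ)⁻¹ • ((x * (y + z)) • A + (y * (z + x)) • B + (z * (x + y)) • C) := by
    rw [hQ, AffineMap.homothety_apply, hG, hP', vsub_eq_sub, vadd_eq_add]
    match_scalars <;> field_simp <;> rw [hσdef] <;> ring
  have hKQ : AffineMap.homothety G (-(1 / 2) : ℝ) Q =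
      (4 * σ)⁻¹ • ((x * y + z * x + 2 * (y * z)) • A + (x * y + y * z + 2 * (z * x)) • B +
        (y * z + z * x + 2 * (x * y)) • C) := by
    rw [AffineMap.homothety_apply, hG, hQ', vsub_eq_sub, vadd_eq_add]
    match_scalars <;> field_simp <;> rw [hσdef] <;> ring
  have huvw := cevian_preimage_weights_sum hx hy hz hσdef hσ
  have hcomb := cevian_preimage_combination A B C hx hy hz hσdef hσ
  set u := (y + z) ^ 2 * (σ - x ^ 2) / (8 * σ * (y * z)) with hu
  set v := (z + x) ^ 2 * (σ - y ^ 2) / (8 * σ * (z * x)) with hv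
  set w := (x + y) ^ 2 * (σ - z ^ 2) / (8 * σ * (x * y)) with hw
  have hTsymm : T.symm (AffineMap.homothety G (-(1 / 2) : ℝ) Q) = u • A + v • B + w • C := by
    have hT := T.toAffineMap.map_smul_add_smul_add_smul huvw A B C
    simp only [AffineEquiv.coe_toAffineMap, hTA, hTB, hTC] at hT
    rw [hKQ, ← hcomb, ← hD₃, ← hE₃, ← hF₃, ← hT, AffineEquiv.symm_apply_apply]
  have hH' : H = (1 - 2 * u) • A + (1 - 2 * v) • B + (1 - 2 * w) • C := by
    rw [hH, hTsymm, AffineMap.homothety_apply, hG, vsub_eq_sub, vadd_eq_add]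
    match_scalars <;> ring
  have hline (k : ℝ) : AffineMap.lineMap D D₃ k = (0 : ℝ) • A +
      (((1 - k) * y + k * z) / (y + z)) • B + (((1 - k) * z + k * y) / (y + z)) • C := by
    rw [AffineMap.lineMap_apply_module, hD, hD₃]
    match_scalars <;> field_simp
  have hsum_line (k : ℝ) :
      0 + ((1 - k) * y + k * z) / (y + z) + ((1 - k) * z + k * y) / (y + z) = 1 := by
    field_simp
    ring
  have hline_diff (k : ℝ) :
      z * (((1 - k) * y + k * z) / (y + z)) - y * (((1 - k) * z + k * y) / (y + z)) =
        k * (z - y) := by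
    field_simp
    ring
  obtain ⟨q, hq⟩ := mem_affineSpan_pair_iff_exists_lineMap_eq.1 hD₂AQ
  obtain ⟨r, hr⟩ := mem_affineSpan_pair_iff_exists_lineMap_eq.1 hHaAH
  have ht_eq : t * (x * y + 2 * (y * z) + z * x) = y * z := by
    have hq' : (1 - q + q * (x * (y + z) / (2 * σ))) • A + (q * (y * (z + x) / (2 * σ))) • B +
        (q * (z * (x + y) / (2 * σ))) • C = AffineMap.lineMap D D₃ t := by
      rw [← ht, ← hq, AffineMap.lineMap_apply_module, hQ']
      match_scalars <;> field_simp
    rw [hline] at hq'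
    obtain ⟨h₁, h₂, h₃⟩ := hABC.coord_eq_of_smul_add_eq
      (by rw [hsum_line]; field_simp; rw [hσdef]; ring) hq'
    have h₄ : q * (x * y + 2 * (y * z) + z * x) = 2 * σ := by
      field_simp at h₁
      linear_combination -h₁ - 2 * q * hσdef
    have hq₀ : q ≠ 0 := by
      rintro rfl
      exact hσ (by linarith)
    have h₅ : q * (y * z) = 2 * σ * t := by
      refine mul_right_cancel₀ (sub_ne_zero.2 hyzne.symm) ?_
      have h₆ : q * (y * z * (z - y)) / (2 * σ) = t * (z - y) := by
        linear_combination z * h₂ - y * h₃ + hline_diff t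
      rw [div_eq_iff (mul_ne_zero two_ne_zero hσ)] at h₆
      linear_combination h₆
    refine mul_left_cancel₀ hq₀ ?_
    linear_combination t * h₄ - h₅
  have hs_eq : s * (x * (y + z)) = -(y * z) := by
    have hr' : (1 - r + r * (1 - 2 * u)) • A + (r * (1 - 2 * v)) • B + (r * (1 - 2 * w)) • C =
        AffineMap.lineMap D D₃ s := by
      rw [← hs, ← hr, AffineMap.lineMap_apply_module, hH']
      match_scalars <;> ring
    rw [hline] at hr'
    obtain ⟨h₁, h₂, h₃⟩ := hABC.coord_eq_of_smul_add_eq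
      (by rw [hsum_line]; linear_combination (-2 * r) * huvw) hr'
    have h₄ : x * (y + z) * (z * (1 - 2 * v) - y * (1 - 2 * w)) = -(y * z * (z - y) * (2 * u)) := by
      rw [hu, hv, hw]
      field_simp
      rw [hσdef]
      ring
    have h₅ : r * (z * (1 - 2 * v) - y * (1 - 2 * w)) = s * (z - y) := by
      linear_combination z * h₂ - y * h₃ + hline_diff s
    refine mul_right_cancel₀ (sub_ne_zero.2 hyzne.symm) ?_
    linear_combination r * h₄ - x * (y + z) * h₅ + y * z * (z - y) * h₁
  refine mul_left_cancel₀ (mul_ne_zero hy hz) ?_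
  linear_combination t * hs_eq - s * ht_eq
end

section
/- Suppose H_a lies on line BC and on line AH with H ≠ A, where H is the generalized orthocenter of P. Then the midpoint of segment AH_a lies on the line through Q and D₃. -/
/-- A vanishing linear combination of three affinely independent points whose coefficients sum to
zero is trivial. -/
lemma AffineIndependent.smul_eq_zero_three {V : Type*} [AddCommGroup V] [Module ℝ V] {A B C : V}
    (h : AffineIndependent ℝ ![A, B, C]) {a b c : ℝ} (hs : a + b + c = 0)
    (hv : a • A + b • B + c • C = 0) : a = 0 ∧ b = 0 ∧ c = 0 := by
  have key := affineIndependent_iff.mp h Finset.univ ![a, b, c]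
    (by simpa [Fin.sum_univ_three] using hs) (by simpa [Fin.sum_univ_three] using hv)
  exact ⟨key 0 (Finset.mem_univ _), key 1 (Finset.mem_univ _), key 2 (Finset.mem_univ _)⟩

/-- Affine equivalences preserve affine combinations of three points. -/
lemma AffineEquiv.map_smul_add_smul_add_smul {V : Type*} [AddCommGroup V] [Module ℝ V]
    (T : V ≃ᵃ[ℝ] V) (A B C : V) {a b c : ℝ} (hs : a + b + c = 1) :
    T (a • A + b • B + c • C) = a • T A + b • T B + c • T C := by
  obtain rfl : a = 1 - b - c := by linarith
  have h (p : V) : T p = T.linear p + T 0 := by simpa using T.map_vadd 0 p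
  rw [h, h A, h B, h C]
  simp only [map_add, map_smul]
  module

/-- The barycentric coordinates of the complement of the generalized orthocenter: the preimage
under `T` of the complement of `Q`. -/
lemma symm_apply_complement_eq {V : Type*} [AddCommGroup V] [Module ℝ V] (T : V ≃ᵃ[ℝ] V)
    {A B C : V} {x y z σ : ℝ} (hx : x ≠ 0) (hy : y ≠ 0) (hz : z ≠ 0)
    (hyz : y + z ≠ 0) (hzx : z + x ≠ 0) (hxy : x + y ≠ 0)
    (hσdef : σ = x * y + y * z + z * x) (hσ : σ ≠ 0)
    (hTA : T A = (y + z)⁻¹ • (z • B + y • C))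
    (hTB : T B = (z + x)⁻¹ • (x • C + z • A))
    (hTC : T C = (x + y)⁻¹ • (y • A + x • B)) :
    T.symm ((4 * σ)⁻¹ • ((σ + y * z) • A + (σ + z * x) • B + (σ + x * y) • C)) =
      ((y + z) ^ 2 * (σ - x ^ 2) / (8 * (y * z * σ))) • A +
      ((z + x) ^ 2 * (σ - y ^ 2) / (8 * (z * x * σ))) • B +
      ((x + y) ^ 2 * (σ - z ^ 2) / (8 * (x * y * σ))) • C := by
  rw [← T.injective.eq_iff, T.apply_symm_apply, T.map_smul_add_smul_add_smul, hTA, hTB, hTC]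
  · match_scalars <;> field_simp <;> rw [hσdef] <;> ring
  · field_simp
    rw [hσdef]
    ring


/-- If `H_a` is the trace of the generalized orthocenter `H` on `BC` (with `H ≠ A`),
then the midpoint of segment `AH_a` lies on the line through `Q` and `D₃`. -/
theorem midpoint_A_Ha_mem_line_Q_D₃
    (A B C G P P' Q D E F D₀ E₀ F₀ D₃ E₃ F₃ : EuclideanSpace ℝ (Fin 2))
    (x y z σ : ℝ)
    (hABC : AffineIndependent ℝ ![A, B, C])
    (hG : G = (3 : ℝ)⁻¹ • (A + B + C))
    (hsum : x + y + z = 1)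
    (hx : x ≠ 0) (hy : y ≠ 0) (hz : z ≠ 0)
    (hyz : y + z ≠ 0) (hzx : z + x ≠ 0) (hxy : x + y ≠ 0)
    (hP : P = x • A + y • B + z • C)
    (hD : D = (y + z)⁻¹ • (y • B + z • C))
    (hE : E = (z + x)⁻¹ • (z • C + x • A))
    (hF : F = (x + y)⁻¹ • (x • A + y • B))
    (hD₀ : D₀ = midpoint ℝ B C) (hE₀ : E₀ = midpoint ℝ C A) (hF₀ : F₀ = midpoint ℝ A B)
    (hσdef : σ = x * y + y * z + z * x) (hσ : σ ≠ 0)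
    (hP' : P' = σ⁻¹ • ((y * z) • A + (z * x) • B + (x * y) • C))
    (hD₃ : D₃ = Equiv.pointReflection D₀ D)
    (hE₃ : E₃ = Equiv.pointReflection E₀ E)
    (hF₃ : F₃ = Equiv.pointReflection F₀ F)
    (hD₃E₃F₃ : AffineIndependent ℝ ![D₃, E₃, F₃])
    (hQ : Q = AffineMap.homothety G (-(1 / 2) : ℝ) P')
    (T : EuclideanSpace ℝ (Fin 2) ≃ᵃ[ℝ] EuclideanSpace ℝ (Fin 2))
    (hTA : T A = D₃) (hTB : T B = E₃) (hTC : T C = F₃)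
    (H : EuclideanSpace ℝ (Fin 2))
    (hH : H = AffineMap.homothety G (-2 : ℝ)
      (T.symm (AffineMap.homothety G (-(1 / 2) : ℝ) Q)))
    (Ha : EuclideanSpace ℝ (Fin 2))
    (hHaBC : Ha ∈ line[ℝ, B, C]) (hHaAH : Ha ∈ line[ℝ, A, H]) (hHA : H ≠ A) :
    midpoint ℝ A Ha ∈ line[ℝ, Q, D₃] := by
  have hA : T A = (y + z)⁻¹ • (z • B + y • C) := by
    rw [hTA, hD₃, hD₀, hD, Equiv.pointReflection_apply, midpoint_eq_smul_add, invOf_eq_inv,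
      vsub_eq_sub, vadd_eq_add]
    match_scalars <;> field_simp <;> ring
  have hB : T B = (z + x)⁻¹ • (x • C + z • A) := by
    rw [hTB, hE₃, hE₀, hE, Equiv.pointReflection_apply, midpoint_eq_smul_add, invOf_eq_inv,
      vsub_eq_sub, vadd_eq_add]
    match_scalars <;> field_simp <;> ring
  have hC : T C = (x + y)⁻¹ • (y • A + x • B) := by
    rw [hTC, hF₃, hF₀, hF, Equiv.pointReflection_apply, midpoint_eq_smul_add, invOf_eq_inv,
      vsub_eq_sub, vadd_eq_add]
    match_scalars <;> field_simp <;> ring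
  have hQ' : Q = (2 * σ)⁻¹ • ((x * (y + z)) • A + (y * (z + x)) • B + (z * (x + y)) • C) := by
    rw [hQ, hG, hP', AffineMap.homothety_apply, vsub_eq_sub, vadd_eq_add]
    match_scalars <;> field_simp <;> rw [hσdef] <;> ring
  have hKQ : AffineMap.homothety G (-(1 / 2) : ℝ) Q =
      (4 * σ)⁻¹ • ((σ + y * z) • A + (σ + z * x) • B + (σ + x * y) • C) := by
    rw [hQ', hG, AffineMap.homothety_apply, vsub_eq_sub, vadd_eq_add]
    match_scalars <;> field_simp <;> rw [hσdef] <;> ring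
  rw [hKQ, symm_apply_complement_eq T hx hy hz hyz hzx hxy hσdef hσ hA hB hC, hG,
    AffineMap.homothety_apply, vsub_eq_sub, vadd_eq_add] at hH
  obtain ⟨r, hr⟩ := mem_affineSpan_pair_iff_exists_lineMap_eq.mp hHaBC
  obtain ⟨t, ht⟩ := mem_affineSpan_pair_iff_exists_lineMap_eq.mp hHaAH
  rw [AffineMap.lineMap_apply_module'] at hr ht
  -- the barycentric coordinates of `Ha` computed on the two lines agree
  obtain ⟨ha, hb, -⟩ := hABC.smul_eq_zero_three
    (a := 1 - t * ((y + z) ^ 2 * (σ - x ^ 2) / (4 * (y * z * σ))))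
    (b := t * (1 - (z + x) ^ 2 * (σ - y ^ 2) / (4 * (z * x * σ))) - (1 - r))
    (c := t * (1 - (x + y) ^ 2 * (σ - z ^ 2) / (4 * (x * y * σ))) - r)
    (by
      field_simp
      rw [hσdef]
      ring)
    (by
      rw [← sub_eq_zero.mpr (ht.trans hr.symm), hH]
      match_scalars <;> field_simp <;> ring)
  have ht' : t * ((y + z) ^ 2 * (σ - x ^ 2)) = 4 * (y * z * σ) := by
    field_simp at ha
    linear_combination -ha
  have hb' : t * ((σ - z ^ 2) * (σ - x ^ 2)) = (1 - r) * (4 * (z * x * σ)) := by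
    field_simp at hb
    rw [hσdef] at hb ⊢
    linear_combination hb
  have hr' : x * (y + z) ^ 2 * (1 - r) = y * (σ - z ^ 2) := by
    have h : (4 * (z * σ)) * (x * (y + z) ^ 2 * (1 - r)) = (4 * (z * σ)) * (y * (σ - z ^ 2)) := by
      linear_combination (σ - z ^ 2) * ht' - (y + z) ^ 2 * hb'
    exact mul_left_cancel₀ (by positivity) h
  refine mem_affineSpan_pair_iff_exists_lineMap_eq.mpr ⟨1 - σ / (x * (y + z)), ?_⟩
  obtain rfl : r = 1 - y * (σ - z ^ 2) / (x * (y + z) ^ 2) := by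
    field_simp
    linear_combination -hr'
  rw [AffineMap.lineMap_apply_module', ← hTA, hA, hQ', ← hr, midpoint_eq_smul_add, invOf_eq_inv]
  match_scalars <;> field_simp <;> rw [hσdef] <;> ring
end
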